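/- arXiv:1710.08937 — 5 statements merged into one kernel-verified Lean document; each statement's English description precedes it below -/
import Mathlib

section
/- Let x be a finite rational time series and let x̃ denote its condensation. Then for every finite rational time series y, dtw(x̃, y) ≤ dtw(x, y). -/
/-- A warping path of order `m × n` (pairs are 1-indexed): it starts at `(1,1)`,
ends at `(m,n)`, stays within `[m] × [n]`, and each step is one of
`(+1,0)`, `(0,+1)`, `(+1,+1)`. -/
def IsWarpingPath (m n : ℕ) (p : List (ℕ × ℕ)) : Prop :=
  p.head? = some (1, 1) ∧
  p.getLast? = some (m, n) ∧
  (∀ q ∈ p, 1 ≤ q.1 ∧ q.1 ≤ m ∧ 1 ≤ q.2 ∧ q.2 ≤ n) ∧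
  ∀ ℓ : ℕ, ℓ + 1 < p.length →
    ((p.getD (ℓ + 1) (0, 0)).1 = (p.getD ℓ (0, 0)).1 + 1 ∧
       (p.getD (ℓ + 1) (0, 0)).2 = (p.getD ℓ (0, 0)).2) ∨
    ((p.getD (ℓ + 1) (0, 0)).1 = (p.getD ℓ (0, 0)).1 ∧
       (p.getD (ℓ + 1) (0, 0)).2 = (p.getD ℓ (0, 0)).2 + 1) ∨
    ((p.getD (ℓ + 1) (0, 0)).1 = (p.getD ℓ (0, 0)).1 + 1 ∧
       (p.getD (ℓ + 1) (0, 0)).2 = (p.getD ℓ (0, 0)).2 + 1)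

/-- The cost `C_p(x,y)` of aligning time series `x` and `y` (1-indexed, given as
lists of rationals) along the warping path `p`. -/
def alignCost (x y : List ℚ) (p : List (ℕ × ℕ)) : ℚ :=
  (p.map fun q => (x.getD (q.1 - 1) 0 - y.getD (q.2 - 1) 0) ^ 2).sum

/-- The squared dtw-distance: the minimum alignment cost over all warping paths
of order `x.length × y.length`. -/
noncomputable def dtwSq (x y : List ℚ) : ℝ :=
  sInf {c : ℝ | ∃ p : List (ℕ × ℕ),
    IsWarpingPath x.length y.length p ∧ c = (alignCost x y p : ℝ)}

/-- The dtw-distance. -/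
noncomputable def dtw (x y : List ℚ) : ℝ := Real.sqrt (dtwSq x y)

/-- A time series is condensed if no two consecutive elements are equal. -/
def IsCondensed (x : List ℚ) : Prop := x.Chain' (· ≠ ·)

/-- The condensation of a time series: repeatedly remove one of two equal
consecutive elements until the series is condensed. -/
def condense (x : List ℚ) : List ℚ := x.destutter (· ≠ ·)

/-- The admissible steps of a warping path. -/
def IsWarpingStep (a b : ℕ × ℕ) : Prop :=
  (b.1 = a.1 + 1 ∧ b.2 = a.2) ∨ (b.1 = a.1 ∧ b.2 = a.2 + 1) ∨ (b.1 = a.1 + 1 ∧ b.2 = a.2 + 1)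

lemma isWarpingPath_iff {m n : ℕ} {p : List (ℕ × ℕ)} :
    IsWarpingPath m n p ↔ p.head? = some (1, 1) ∧ p.getLast? = some (m, n) ∧
      (∀ q ∈ p, 1 ≤ q.1 ∧ q.1 ≤ m ∧ 1 ≤ q.2 ∧ q.2 ≤ n) ∧ p.IsChain IsWarpingStep := by
  unfold IsWarpingPath
  refine and_congr_right fun _ => and_congr_right fun _ => and_congr_right fun _ => ?_
  rw [List.isChain_iff_getElem]
  refine forall_congr' fun i => forall_congr' fun hi => ?_
  rw [List.getD_eq_getElem _ _ hi, List.getD_eq_getElem _ _ (Nat.lt_of_succ_lt hi)]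
  rfl

lemma IsWarpingPath.append_singleton {m n m' n' : ℕ} {p : List (ℕ × ℕ)}
    (hp : IsWarpingPath m n p) (h : IsWarpingStep (m, n) (m', n')) :
    IsWarpingPath m' n' (p ++ [(m', n')]) := by
  rw [isWarpingPath_iff] at hp ⊢
  obtain ⟨h₁, h₂, h₃, h₄⟩ := hp
  have hmn := h₃ _ (List.mem_of_getLast? h₂)
  simp only [IsWarpingStep] at h
  refine ⟨by simp [List.head?_append, h₁], by simp, ?_, ?_⟩
  · intro q hq
    rcases List.mem_append.1 hq with hq | hq
    · have := h₃ q hq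
      omega
    · rw [List.mem_singleton.1 hq]
      simp only at hmn ⊢
      omega
  · refine h₄.append (List.isChain_singleton _) ?_
    intro a ha b hb
    rw [h₂] at ha
    simp only [Option.mem_def, Option.some.injEq, List.head?_cons] at ha hb
    subst ha hb
    exact h

lemma exists_isWarpingPath (m n : ℕ) : ∃ p, IsWarpingPath (m + 1) (n + 1) p := by
  induction m with
  | zero =>
    induction n with
    | zero => exact ⟨[(1, 1)], isWarpingPath_iff.2 (by simp)⟩
    | succ n ih =>
      obtain ⟨p, hp⟩ := ih
      exact ⟨_, hp.append_singleton (Or.inr (Or.inl ⟨rfl, rfl⟩))⟩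
  | succ m ih =>
    obtain ⟨p, hp⟩ := ih
    exact ⟨_, hp.append_singleton (Or.inl ⟨rfl, rfl⟩)⟩

/-- Removing stationary steps from a chain leaves a chain with the same endpoints. -/
lemma List.IsChain.exists_sublist_of_eq_or {α : Type*} {R : α → α → Prop} {l : List α}
    (h : l.IsChain fun a b => a = b ∨ R a b) :
    ∃ l' : List α, l'.Sublist l ∧ l'.IsChain R ∧ l'.head? = l.head? ∧
      l'.getLast? = l.getLast? := by
  induction l with
  | nil => exact ⟨[], by simp⟩
  | cons a l ih =>
    cases l with
    | nil => exact ⟨[a], by simp⟩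
    | cons b t =>
      rw [List.isChain_cons_cons] at h
      obtain ⟨l', hs, hc, hh, hl⟩ := ih h.2
      rcases h.1 with rfl | hab
      · exact ⟨l', hs.trans (List.sublist_cons_self _ _), hc, by simpa using hh, by simpa using hl⟩
      · refine ⟨a :: l', hs.cons_cons a, hc.cons ?_, rfl, ?_⟩
        · intro c hc'
          rw [hh] at hc'
          simp only [List.head?_cons, Option.mem_def, Option.some.injEq] at hc'
          exact hc' ▸ hab
        · simp [List.getLast?_cons, hl]

lemma condense_cons_cons (a b : ℚ) (l : List ℚ) :
    condense (a :: b :: l) = if a = b then condense (b :: l) else a :: condense (b :: l) := by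
  unfold condense
  rw [List.destutter_cons_cons]
  by_cases h : a = b
  · subst h
    simp [List.destutter]
  · simp [h, List.destutter]

/-- The map sending each (0-based) index of `x` to the index of its block in the condensation. -/
lemma exists_condense_index (a : ℚ) (l : List ℚ) :
    ∃ f : ℕ → ℕ, f 0 = 0 ∧ f l.length + 1 = (condense (a :: l)).length ∧
      (∀ i, f (i + 1) = f i ∨ f (i + 1) = f i + 1) ∧
      (∀ i ≤ l.length, f i < (condense (a :: l)).length ∧
        (condense (a :: l)).getD (f i) 0 = (a :: l).getD i 0) := by
  induction l generalizing a with
  | nil =>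
    refine ⟨fun _ => 0, rfl, by simp [condense], fun _ => Or.inl rfl, ?_⟩
    intro i hi
    obtain rfl : i = 0 := by simpa using hi
    simp [condense]
  | cons b l ih =>
    obtain ⟨f, h0, hl, hs, hv⟩ := ih b
    rw [condense_cons_cons]
    split_ifs with hab
    · subst hab
      refine ⟨fun i => f (i - 1), h0, by simpa using hl, ?_, ?_⟩
      · rintro (_ | i)
        · exact Or.inl rfl
        · exact hs i
      · rintro (_ | i) hi
        · simpa using hv 0 (Nat.zero_le _)
        · simpa using hv i (by simpa using hi)
    · refine ⟨fun i => i.casesOn 0 fun j => f j + 1, rfl, by simpa using hl, ?_, ?_⟩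
      · rintro (_ | i)
        · exact Or.inr (by simp [h0])
        · have := hs i
          simp only
          omega
      · rintro (_ | i) hi
        · simp
        · simpa using hv i (by simpa using hi)

lemma alignCost_nonneg (x y : List ℚ) (p : List (ℕ × ℕ)) : 0 ≤ alignCost x y p := by
  refine List.sum_nonneg fun a ha => ?_
  obtain ⟨q, -, rfl⟩ := List.mem_map.1 ha
  positivity

lemma alignCost_le_of_sublist (x y : List ℚ) {p q : List (ℕ × ℕ)} (h : p.Sublist q) :
    alignCost x y p ≤ alignCost x y q := by
  refine (h.map _).sum_le_sum fun a ha => ?_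
  obtain ⟨r, -, rfl⟩ := List.mem_map.1 ha
  positivity

/-- Every alignment of `x` with `y` induces one of the condensation of `x` with `y` that is
at most as expensive. -/
lemma IsWarpingPath.exists_condense {x y : List ℚ} {p : List (ℕ × ℕ)}
    (hp : IsWarpingPath x.length y.length p) :
    ∃ q, IsWarpingPath (condense x).length y.length q ∧
      alignCost (condense x) y q ≤ alignCost x y p := by
  obtain ⟨h₁, h₂, h₃, h₄⟩ := isWarpingPath_iff.1 hp
  cases x with
  | nil => exact ⟨p, hp, le_rfl⟩
  | cons a l =>
    obtain ⟨f, h0, hl, hs, hv⟩ := exists_condense_index a l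
    set g : ℕ × ℕ → ℕ × ℕ := fun q => (f (q.1 - 1) + 1, q.2) with hg
    have hchain : (p.map g).IsChain fun a b => a = b ∨ IsWarpingStep a b := by
      rw [List.isChain_map]
      refine h₄.imp_of_mem_imp ?_
      rintro ⟨i, j⟩ ⟨i', j'⟩ hi - hstep
      have hi1 := (h₃ _ hi).1
      obtain ⟨k, rfl⟩ : ∃ k, i = k + 1 := ⟨i - 1, by simp only at hi1; omega⟩
      have hk := hs k
      simp only [IsWarpingStep, hg, Prod.mk.injEq] at hstep ⊢
      rcases hstep with ⟨rfl, rfl⟩ | ⟨rfl, rfl⟩ | ⟨rfl, rfl⟩ <;>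
        simp only [Nat.add_sub_cancel, and_true, true_and, true_or, or_true] <;> omega
    obtain ⟨q, hsub, hc, hh, hlast⟩ := hchain.exists_sublist_of_eq_or
    refine ⟨q, isWarpingPath_iff.2 ⟨?_, ?_, ?_, hc⟩, ?_⟩
    · simp [hh, h₁, hg, h0]
    · simp [hlast, h₂, hg, hl]
    · intro r hr
      obtain ⟨s, hs', rfl⟩ := List.mem_map.1 (hsub.subset hr)
      have hb := h₃ s hs'
      rw [List.length_cons] at hb
      have := (hv (s.1 - 1) (by omega)).1
      simp only [hg]
      omega
    · refine (alignCost_le_of_sublist _ _ hsub).trans (le_of_eq ?_)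
      unfold alignCost
      rw [List.map_map]
      congr 1
      refine List.map_congr_left fun s hs' => ?_
      have hb := h₃ s hs'
      rw [List.length_cons] at hb
      simp only [Function.comp, hg, Nat.add_sub_cancel, (hv (s.1 - 1) (by omega)).2]

lemma dtwSq_eq_zero_of_length_eq_zero {x y : List ℚ} (h : y.length = 0) : dtwSq x y = 0 := by
  unfold dtwSq
  convert Real.sInf_empty
  refine Set.eq_empty_of_forall_notMem ?_
  rintro _ ⟨p, ⟨-, hlast, hb, -⟩, -⟩
  have := hb _ (List.mem_of_getLast? hlast)
  simp only at this
  omega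

lemma dtwSq_condense_le (x y : List ℚ) : dtwSq (condense x) y ≤ dtwSq x y := by
  cases y with
  | nil => rw [dtwSq_eq_zero_of_length_eq_zero rfl, dtwSq_eq_zero_of_length_eq_zero rfl]
  | cons b y =>
    cases x with
    | nil => exact le_rfl
    | cons a x =>
      obtain ⟨p, hp⟩ := exists_isWarpingPath x.length y.length
      refine le_csInf ⟨_, p, hp, rfl⟩ ?_
      rintro _ ⟨p, hp, rfl⟩
      obtain ⟨q, hq, hle⟩ := hp.exists_condense
      refine le_trans (csInf_le ⟨0, ?_⟩ ⟨q, hq, rfl⟩) (Rat.cast_le.2 hle)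
      rintro _ ⟨r, -, rfl⟩
      exact_mod_cast alignCost_nonneg _ _ r

/-- For every finite rational time series `x` with condensation `x̃`, and every
finite rational time series `y`, we have `dtw(x̃, y) ≤ dtw(x, y)`. -/
theorem dtw_condense_le (x y : List ℚ) :
    dtw (condense x) y ≤ dtw x y :=
  Real.sqrt_le_sqrt (dtwSq_condense_le x y)
end

section
/- Let x = (x_1, …, x_n) and y = (y_1, …, y_m) be condensed binary time series (all elements in {0,1}) with n ≥ m and x_1 = y_1. Then dtw(x, y)² = ⌈(n − m)/2⌉. -/
/-- A binary time series: every element is `0` or `1`. -/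
def IsBinary (x : List ℚ) : Prop := ∀ a ∈ x, a = 0 ∨ a = 1

/-- A condensed binary time series alternates between its first element and the other bit. -/
theorem getD_of_isBinary_of_isCondensed {x : List ℚ} (hb : IsBinary x) (hc : IsCondensed x)
    {i : ℕ} (hi : i < x.length) :
    x.getD i 0 = if i % 2 = 0 then x.getD 0 0 else 1 - x.getD 0 0 := by
  induction i with
  | zero => simp
  | succ i ih =>
    have hne : x[i] ≠ x[i + 1] := List.isChain_iff_getElem.1 hc i hi
    have h0 : 0 < x.length := by omega
    have h₀ := hb _ (List.getElem_mem h0)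
    have h₁ := hb _ (List.getElem_mem hi)
    have ih := ih (by omega)
    rw [List.getD_eq_getElem _ _ h0] at ih ⊢
    rw [List.getD_eq_getElem _ _ (by omega)] at ih
    rw [List.getD_eq_getElem _ _ hi]
    rw [ih] at hne
    grind

/-- Two alternating time series with the same first element differ at a pair of indices exactly
when the indices have different parities. -/
theorem sq_sub_getD_eq_mod_two {x y : List ℚ} (hbx : IsBinary x) (hby : IsBinary y)
    (hcx : IsCondensed x) (hcy : IsCondensed y) (h1 : x.getD 0 0 = y.getD 0 0) {i j : ℕ}
    (hi : i < x.length) (hj : j < y.length) :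
    (x.getD i 0 - y.getD j 0) ^ 2 = (((i + j) % 2 : ℕ) : ℚ) := by
  have h0 : 0 < y.length := by omega
  have h₀ := hby _ (List.getElem_mem h0)
  rw [getD_of_isBinary_of_isCondensed hbx hcx hi, getD_of_isBinary_of_isCondensed hby hcy hj, h1,
    List.getD_eq_getElem _ _ h0]
  rcases Nat.mod_two_eq_zero_or_one i with hi | hi <;>
    rcases Nat.mod_two_eq_zero_or_one j with hj | hj <;>
    rcases h₀ with h | h <;> simp [Nat.add_mod, hi, hj, h]

/-- The cost of the first `ℓ + 1` cells of a warping path bounds half the distance of the last of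
these cells from the diagonal, rounded up. -/
theorem le_alignCost_take {x y : List ℚ} (hbx : IsBinary x) (hby : IsBinary y)
    (hcx : IsCondensed x) (hcy : IsCondensed y) (h1 : x.getD 0 0 = y.getD 0 0)
    {p : List (ℕ × ℕ)} (hp : IsWarpingPath x.length y.length p) {ℓ : ℕ} (hℓ : ℓ < p.length) :
    ((((p.getD ℓ (0, 0)).1 - (p.getD ℓ (0, 0)).2 + 1 : ℤ) / 2 : ℤ) : ℚ) ≤
      alignCost x y (p.take (ℓ + 1)) := by
  obtain ⟨hhead, -, hbd, hstep⟩ := hp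
  induction ℓ with
  | zero =>
    cases p with
    | nil => simp at hℓ
    | cons q p =>
      obtain rfl : q = (1, 1) := by simpa using hhead
      simp only [alignCost, List.getD_cons_zero, List.take_succ_cons, List.take_zero,
        List.map_cons, List.map_nil, List.sum_cons, List.sum_nil]
      norm_num
      positivity
  | succ ℓ ih =>
    have ih := ih (by omega)
    have hs := hstep ℓ hℓ
    have hb := hbd _ (List.getElem_mem hℓ)
    rw [List.getD_eq_getElem _ _ hℓ] at hs ⊢
    set r := p.getD ℓ (0, 0)
    set q := p[ℓ + 1] with hq
    have hcost : alignCost x y (p.take (ℓ + 1 + 1)) =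
        alignCost x y (p.take (ℓ + 1)) + (((q.1 - 1 + (q.2 - 1)) % 2 : ℕ) : ℚ) := by
      rw [← sq_sub_getD_eq_mod_two hbx hby hcx hcy h1 (by omega) (by omega)]
      simp [alignCost, List.take_add_one, List.getElem?_eq_getElem hℓ, hq, add_assoc]
    have hkey : ((q.1 - q.2 + 1 : ℤ) / 2) ≤
        (r.1 - r.2 + 1 : ℤ) / 2 + ((q.1 - 1 + (q.2 - 1)) % 2 : ℕ) := by
      omega
    rw [hcost]
    have hkey' : (((q.1 - q.2 + 1 : ℤ) / 2 : ℤ) : ℚ) ≤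
        (((r.1 - r.2 + 1 : ℤ) / 2 : ℤ) : ℚ) + (((q.1 - 1 + (q.2 - 1)) % 2 : ℕ) : ℚ) := by
      rw [← Int.cast_natCast (R := ℚ), ← Int.cast_add]
      exact Int.cast_le.2 hkey
    linarith

theorem le_alignCost {x y : List ℚ} (hbx : IsBinary x) (hby : IsBinary y)
    (hcx : IsCondensed x) (hcy : IsCondensed y) (hnm : y.length ≤ x.length)
    (h1 : x.getD 0 0 = y.getD 0 0)
    {p : List (ℕ × ℕ)} (hp : IsWarpingPath x.length y.length p) :
    (((x.length - y.length + 1) / 2 : ℕ) : ℚ) ≤ alignCost x y p := by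
  have hpos : 0 < p.length := by
    rcases p with _ | _
    · simpa using hp.1
    · simp
  have hlast : p.getD (p.length - 1) (0, 0) = (x.length, y.length) := by
    have := hp.2.1
    rw [List.getLast?_eq_getElem?] at this
    simp [List.getD, this]
  have h := le_alignCost_take hbx hby hcx hcy h1 hp (Nat.sub_lt hpos one_pos)
  rw [hlast, show p.length - 1 + 1 = p.length by omega, List.take_length] at h
  refine le_trans (le_of_eq ?_) h
  rw [← Int.cast_natCast (R := ℚ)]
  congr 1
  push_cast [Nat.cast_sub hnm]
  rfl

/-- The warping path that follows the diagonal as long as possible and then keeps its second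
index constant. -/
def diagonalPath (n m : ℕ) : List (ℕ × ℕ) :=
  (List.range n).map fun i => (i + 1, min (i + 1) m)

theorem isWarpingPath_diagonalPath {n m : ℕ} (hm : 0 < m) (hnm : m ≤ n) :
    IsWarpingPath n m (diagonalPath n m) := by
  refine ⟨?_, ?_, ?_, fun ℓ hℓ => ?_⟩
  · simp only [diagonalPath, List.head?_map, List.head?_range]
    rw [if_neg (by omega)]
    simp
    omega
  · simp only [diagonalPath, List.getLast?_map, List.getLast?_range]
    rw [if_neg (by omega)]
    simp
    omega
  · simp only [diagonalPath, List.mem_map, List.mem_range]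
    rintro _ ⟨i, hi, rfl⟩
    dsimp only
    omega
  · rw [List.getD_eq_getElem _ _ hℓ, List.getD_eq_getElem _ _ (by omega)]
    simp only [diagonalPath, List.getElem_map, List.getElem_range, true_and]
    omega

theorem alignCost_diagonalPath {x y : List ℚ} (hbx : IsBinary x) (hby : IsBinary y)
    (hcx : IsCondensed x) (hcy : IsCondensed y) (hm : 0 < y.length)
    (h1 : x.getD 0 0 = y.getD 0 0) {k : ℕ} (hk : k ≤ x.length) :
    alignCost x y (diagonalPath k y.length) = (((k - y.length + 1) / 2 : ℕ) : ℚ) := by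
  induction k with
  | zero => simp [alignCost, diagonalPath]
  | succ k ih =>
    have hcost : alignCost x y (diagonalPath (k + 1) y.length) =
        alignCost x y (diagonalPath k y.length) +
          (((k + (min (k + 1) y.length - 1)) % 2 : ℕ) : ℚ) := by
      rw [← sq_sub_getD_eq_mod_two hbx hby hcx hcy h1 (by omega) (by omega)]
      simp [alignCost, diagonalPath, List.range_succ]
    rw [hcost, ih (by omega)]
    norm_cast
    omega

/-- For condensed binary time series `x`, `y` of lengths `n ≥ m ≥ 1` with
`x₁ = y₁`, the squared dtw-distance is `⌈(n-m)/2⌉`. -/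
theorem dtwSq_condensed_binary_eq_firstElemEq (x y : List ℚ)
    (hbx : IsBinary x) (hby : IsBinary y)
    (hcx : IsCondensed x) (hcy : IsCondensed y)
    (hm : 0 < y.length) (hnm : y.length ≤ x.length)
    (h1 : x.getD 0 0 = y.getD 0 0) :
    dtwSq x y = (((x.length - y.length + 1) / 2 : ℕ) : ℝ) := by
  refine IsLeast.csInf_eq
    ⟨⟨diagonalPath x.length y.length, isWarpingPath_diagonalPath hm hnm, ?_⟩, ?_⟩
  · rw [alignCost_diagonalPath hbx hby hcx hcy hm h1 le_rfl, Rat.cast_natCast]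
  · rintro _ ⟨p, hp, rfl⟩
    exact_mod_cast le_alignCost hbx hby hcx hcy hnm h1 hp
end

section
/- Let x = (x_1, …, x_n) and y = (y_1, …, y_m) be condensed binary time series (all elements in {0,1}) with n > m and x_1 ≠ y_1. Then dtw(x, y)² = 1 + ⌊(n − m)/2⌋. -/
/-- The cost of a cell when two alternating binary series start with different elements:
`1` if the coordinate sum is even, and `0` otherwise. -/
def parityCost (q : ℕ × ℕ) : ℕ := if Even (q.1 + q.2) then 1 else 0

theorem IsCondensed.getD_eq_of_isBinary {x : List ℚ} (hc : IsCondensed x) (hb : IsBinary x)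
    (i : ℕ) (hi : i < x.length) :
    x.getD i 0 = if Even i then x.getD 0 0 else 1 - x.getD 0 0 := by
  induction i with
  | zero => simp
  | succ k ih =>
    have hk : k < x.length := by omega
    have hne : x[k] ≠ x[k + 1] := List.isChain_iff_getElem.mp hc k hi
    have ih := ih hk
    have hbin (j : ℕ) (hj : j < x.length) : x[j] = 0 ∨ x[j] = 1 := hb _ (List.getElem_mem hj)
    have h0 := hbin 0 (by omega)
    have hbk := hbin k hk
    have hbs := hbin (k + 1) hi
    rw [List.getD_eq_getElem _ _ (by omega : 0 < x.length)] at ih ⊢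
    rw [List.getD_eq_getElem _ _ hk] at ih
    rw [List.getD_eq_getElem _ _ hi]
    by_cases he : Even k <;> simp only [he, Nat.even_add_one, if_true, if_false, not_true,
      not_false_eq_true] at ih ⊢ <;> grind

theorem sq_sub_getD_eq_parityCost {x y : List ℚ}
    (hbx : IsBinary x) (hby : IsBinary y) (hcx : IsCondensed x) (hcy : IsCondensed y)
    (h1 : x.getD 0 0 ≠ y.getD 0 0) {q : ℕ × ℕ}
    (hq : 1 ≤ q.1 ∧ q.1 ≤ x.length ∧ 1 ≤ q.2 ∧ q.2 ≤ y.length) :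
    (x.getD (q.1 - 1) 0 - y.getD (q.2 - 1) 0) ^ 2 = (parityCost q : ℚ) := by
  obtain ⟨i, j⟩ := q
  obtain ⟨hi, hix, hj, hjy⟩ := hq
  obtain ⟨i, rfl⟩ := Nat.exists_eq_add_of_le' hi
  obtain ⟨j, rfl⟩ := Nat.exists_eq_add_of_le' hj
  simp only [Nat.add_sub_cancel] at *
  have hx0 : x.getD 0 0 = 0 ∨ x.getD 0 0 = 1 := by
    rw [List.getD_eq_getElem _ _ (by omega : 0 < x.length)]
    exact hbx _ (List.getElem_mem _)
  have hy0 : y.getD 0 0 = 0 ∨ y.getD 0 0 = 1 := by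
    rw [List.getD_eq_getElem _ _ (by omega : 0 < y.length)]
    exact hby _ (List.getElem_mem _)
  rw [hcx.getD_eq_of_isBinary hbx i (by omega), hcy.getD_eq_of_isBinary hby j (by omega)]
  have hpar : Even (i + 1 + (j + 1)) ↔ (Even i ↔ Even j) := by
    simp only [Nat.even_add, Nat.not_even_one, iff_false]
    tauto
  simp only [parityCost, hpar]
  by_cases hi : Even i <;> by_cases hj : Even j <;> rcases hx0 with hx0 | hx0 <;>
    rcases hy0 with hy0 | hy0 <;> simp only [hx0, hy0, hi, hj] at h1 ⊢ <;>
    first | exact absurd rfl h1 | norm_num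

theorem alignCost_eq_sum_parityCost {x y : List ℚ}
    (hbx : IsBinary x) (hby : IsBinary y) (hcx : IsCondensed x) (hcy : IsCondensed y)
    (h1 : x.getD 0 0 ≠ y.getD 0 0) {p : List (ℕ × ℕ)}
    (hp : IsWarpingPath x.length y.length p) :
    alignCost x y p = ((p.map parityCost).sum : ℕ) := by
  rw [alignCost, List.map_congr_left fun q hq =>
    sq_sub_getD_eq_parityCost hbx hby hcx hcy h1 (hp.2.2.1 q hq)]
  simp [Nat.cast_list_sum, Function.comp_def]

/-- Along a warping path, every prefix has parity cost at least about half the excess of the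
first coordinate over the second at its end. -/
theorem IsWarpingPath.le_sum_take_parityCost {m n : ℕ} {p : List (ℕ × ℕ)}
    (hp : IsWarpingPath m n p) (k : ℕ) (hk : k < p.length) :
    p[k].1 + 1 + parityCost p[k] ≤ 2 * ((p.take (k + 1)).map parityCost).sum + p[k].2 := by
  obtain ⟨hhead, -, -, hstep⟩ := hp
  induction k with
  | zero =>
    rw [List.head?_eq_getElem?, List.getElem?_eq_getElem hk, Option.some_inj] at hhead
    rw [List.take_succ_eq_append_getElem hk]
    simp [hhead, parityCost]
  | succ k ih =>
    have hk' : k < p.length := by omega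
    have ih := ih hk'
    have hs := hstep k hk
    rw [List.getD_eq_getElem _ _ hk', List.getD_eq_getElem _ _ hk] at hs
    rw [List.take_succ_eq_append_getElem hk, List.map_append, List.sum_append]
    simp only [List.map_cons, List.map_nil, List.sum_cons, List.sum_nil, parityCost,
      Nat.even_iff] at ih ⊢
    split_ifs at ih ⊢ <;> omega

theorem IsWarpingPath.le_sum_parityCost {m n : ℕ} {p : List (ℕ × ℕ)}
    (hp : IsWarpingPath n m p) (hnm : m < n) :
    1 + (n - m) / 2 ≤ (p.map parityCost).sum := by
  have hlen : 0 < p.length := List.length_pos_iff.mpr fun h => by simp [h, IsWarpingPath] at hp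
  have hlt : p.length - 1 < p.length := by omega
  have hlast := hp.2.1
  rw [List.getLast?_eq_getElem?, List.getElem?_eq_getElem hlt, Option.some_inj] at hlast
  have h := hp.le_sum_take_parityCost _ hlt
  rw [List.take_of_length_le (by omega), hlast] at h
  have hmn : parityCost (n, m) = if (n + m) % 2 = 0 then 1 else 0 := by
    simp only [parityCost, Nat.even_iff]
  rw [hmn] at h
  split_ifs at h <;> omega

/-- The path `(1,1), (2,1), (3,2), …, (m+1,m), (m+2,m), …, (n,m)`. -/
def shiftedDiagonalPath (n m : ℕ) : List (ℕ × ℕ) :=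
  (List.range n).map fun k => (k + 1, min (max k 1) m)

theorem isWarpingPath_shiftedDiagonalPath {n m : ℕ} (hm : 0 < m) (hnm : m < n) :
    IsWarpingPath n m (shiftedDiagonalPath n m) := by
  have hget (k : ℕ) (hk : k < n) :
      (shiftedDiagonalPath n m)[k]? = some (k + 1, min (max k 1) m) := by
    simp [shiftedDiagonalPath, hk]
  have hlen : (shiftedDiagonalPath n m).length = n := by simp [shiftedDiagonalPath]
  refine ⟨?_, ?_, ?_, ?_⟩
  · rw [List.head?_eq_getElem?, hget 0 (by omega), Option.some_inj, Prod.mk.injEq]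
    omega
  · rw [List.getLast?_eq_getElem?, hlen, hget (n - 1) (by omega), Option.some_inj, Prod.mk.injEq]
    omega
  · simp only [shiftedDiagonalPath, List.mem_map, List.mem_range]
    rintro _ ⟨k, hk, rfl⟩
    dsimp only
    omega
  · intro k hk
    rw [hlen] at hk
    simp only [List.getD_eq_getElem?_getD, hget _ hk, hget k (by omega), Option.getD_some,
      true_and]
    omega

theorem sum_parityCost_shiftedDiagonalPath {n m : ℕ} (hm : 0 < m) (hn : 0 < n) :
    ((shiftedDiagonalPath n m).map parityCost).sum = 1 + (n - m) / 2 := by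
  induction n, hn using Nat.le_induction with
  | base =>
    have : min 1 m = 1 := by omega
    simp [shiftedDiagonalPath, parityCost, this]
  | succ k hk ih =>
    simp only [shiftedDiagonalPath, List.range_succ, List.map_append, List.sum_append] at ih ⊢
    rw [ih]
    simp only [List.map_cons, List.map_nil, List.sum_cons, List.sum_nil, parityCost, Nat.even_iff]
    split_ifs <;> omega

/-- For condensed binary time series `x`, `y` of lengths `n > m ≥ 1` with
`x₁ ≠ y₁`, the squared dtw-distance is `1 + ⌊(n-m)/2⌋`. -/
theorem dtwSq_condensed_binary_eq_firstElemNe_gtLen (x y : List ℚ)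
    (hbx : IsBinary x) (hby : IsBinary y)
    (hcx : IsCondensed x) (hcy : IsCondensed y)
    (hm : 0 < y.length) (hnm : y.length < x.length)
    (h1 : x.getD 0 0 ≠ y.getD 0 0) :
    dtwSq x y = 1 + (((x.length - y.length) / 2 : ℕ) : ℝ) := by
  have hcost {p : List (ℕ × ℕ)} (hp : IsWarpingPath x.length y.length p) :
      (alignCost x y p : ℝ) = ((p.map parityCost).sum : ℕ) := by
    rw [alignCost_eq_sum_parityCost hbx hby hcx hcy h1 hp, Rat.cast_natCast]
  refine IsLeast.csInf_eq ⟨⟨shiftedDiagonalPath x.length y.length, ?_, ?_⟩, ?_⟩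
  · exact isWarpingPath_shiftedDiagonalPath hm hnm
  · rw [hcost (isWarpingPath_shiftedDiagonalPath hm hnm),
      sum_parityCost_shiftedDiagonalPath hm (by omega)]
    push_cast
    rfl
  · rintro _ ⟨p, hp, rfl⟩
    rw [hcost hp]
    exact_mod_cast hp.le_sum_parityCost hnm
end

section
/- Let x^(1), …, x^(k) be rational time series, where x^(j) has length n_j, and let w_1, …, w_k be nonnegative rational weights with w_j > 0 for at least one j. For m ∈ ℕ, let p^(j) be a warping path of order m × n_j for each j ∈ [k], and let z be a length-m time series minimizing the total aligned cost Σ_{j=1}^k w_j · C_{p^(j)}(x, x^(j)) over all length-m rational time series x. For each i ∈ [m], let x^(j)_{ℓ_{ij}}, …, x^(j)_{h_{ij}} denote the (consecutive) elements of x^(j) that are aligned with z_i by p^(j). Then for each i ∈ [m], z_i = (Σ_{j=1}^k w_j Σ_{t=ℓ_{ij}}^{h_{ij}} x^(j)_t) / (Σ_{j=1}^k w_j (h_{ij} − ℓ_{ij} + 1)). -/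
/-- A warping path is strictly increasing in the product order. -/
theorem IsWarpingPath.pairwise_lt {m n : ℕ} {p : List (ℕ × ℕ)} (hp : IsWarpingPath m n p) :
    p.Pairwise (· < ·) := by
  rw [← List.isChain_iff_pairwise, List.isChain_iff_getElem]
  intro ℓ hℓ
  have h := hp.2.2.2 ℓ hℓ
  rw [List.getD_eq_getElem _ _ hℓ, List.getD_eq_getElem _ _ (by omega)] at h
  rw [Prod.lt_iff]
  omega

/-- A warping path visits no pair twice. -/
theorem IsWarpingPath.nodup {m n : ℕ} {p : List (ℕ × ℕ)} (hp : IsWarpingPath m n p) :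
    p.Nodup :=
  hp.pairwise_lt.imp ne_of_lt

/-- Every index of the first series is aligned with some index of the second one. -/
theorem IsWarpingPath.exists_mem {m n : ℕ} {p : List (ℕ × ℕ)} (hp : IsWarpingPath m n p)
    {i : ℕ} (hi : 1 ≤ i) (him : i ≤ m) : ∃ t, (i, t) ∈ p := by
  obtain ⟨hhead, hlast, -, hstep⟩ := hp
  have key : ∀ ℓ, (hℓ : ℓ < p.length) → ∀ i, 1 ≤ i → i ≤ (p[ℓ]).1 → ∃ t, (i, t) ∈ p := by
    intro ℓ
    induction ℓ with
    | zero =>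
      intro hℓ i hi hi'
      rw [List.head?_eq_getElem?, List.getElem?_eq_getElem hℓ, Option.some_inj] at hhead
      rw [hhead] at hi'
      obtain rfl : i = 1 := le_antisymm hi' hi
      exact ⟨1, hhead ▸ List.getElem_mem hℓ⟩
    | succ ℓ ih =>
      intro hℓ i hi hi'
      have h := hstep ℓ hℓ
      rw [List.getD_eq_getElem _ _ hℓ, List.getD_eq_getElem _ _ (by omega)] at h
      by_cases hle : i ≤ (p[ℓ]).1
      · exact ih (by omega) i hi hle
      · obtain rfl : i = (p[ℓ + 1]).1 := by omega
        exact ⟨_, List.getElem_mem hℓ⟩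
  rw [List.getLast?_eq_getElem?] at hlast
  obtain ⟨hlt, hget⟩ := List.getElem?_eq_some_iff.mp hlast
  exact key _ hlt i hi (by rw [hget]; exact him)

/-- Changing a single element `z i` affects the alignment cost only through the elements
aligned with it. -/
theorem alignCost_set_sub {m n : ℕ} {p : List (ℕ × ℕ)} (hp : IsWarpingPath m n p)
    (z y : List ℚ) (hz : z.length = m) {i a b : ℕ} (hi : 1 ≤ i) (him : i ≤ m)
    (hab : ∀ t, (i, t) ∈ p ↔ a ≤ t ∧ t ≤ b) (c : ℚ) :
    alignCost (z.set (i - 1) c) y p - alignCost z y p =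
      ∑ t ∈ Finset.Icc a b,
        ((c - y.getD (t - 1) 0) ^ 2 - (z.getD (i - 1) 0 - y.getD (t - 1) 0) ^ 2) := by
  have hset : (z.set (i - 1) c).getD (i - 1) 0 = c := by
    rw [List.getD_eq_getElem _ _ (by rw [List.length_set]; omega), List.getElem_set_self]
  have hne : ∀ q ∈ p, q.1 ≠ i → (z.set (i - 1) c).getD (q.1 - 1) 0 = z.getD (q.1 - 1) 0 := by
    intro q hq hqi
    have := hp.2.2.1 q hq
    simp only [List.getD_eq_getElem?_getD]
    rw [List.getElem?_set_ne (by omega)]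
  unfold alignCost
  rw [← List.sum_toFinset _ hp.nodup, ← List.sum_toFinset _ hp.nodup, ← Finset.sum_sub_distrib]
  have himage : (Finset.Icc a b).image (fun t => (i, t)) ⊆ p.toFinset := by
    intro q hq
    obtain ⟨t, ht, rfl⟩ := Finset.mem_image.mp hq
    exact List.mem_toFinset.mpr ((hab t).mpr (Finset.mem_Icc.mp ht))
  rw [← Finset.sum_subset himage, Finset.sum_image (by simp)]
  · simp only [hset]
  · rintro ⟨q₁, q₂⟩ hq hq'
    have hq := List.mem_toFinset.mp hq
    have hqi : q₁ ≠ i := by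
      rintro rfl
      exact hq' (Finset.mem_image_of_mem _ (Finset.mem_Icc.mpr ((hab q₂).mp hq)))
    rw [hne _ hq hqi, sub_self]

/-- If `z` is a length-`m` rational time series minimizing the total weighted
aligned cost along fixed warping paths `p j` (of order `m × (x j).length`),
and for each `i ∈ [m]` the elements of `x j` aligned with `z i` are exactly
those with (1-indexed) indices in `[ℓ j i, h j i]`, then each `z i` is the
corresponding weighted average of the aligned sample elements. -/
theorem mean_elem_is_weighted_average (k m : ℕ) (x : Fin k → List ℚ)
    (w : Fin k → ℚ) (hw : ∀ j, 0 ≤ w j) (hwpos : ∃ j, 0 < w j)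
    (p : Fin k → List (ℕ × ℕ))
    (hp : ∀ j, IsWarpingPath m (x j).length (p j))
    (lo hi : Fin k → ℕ → ℕ)
    (halign : ∀ (j : Fin k) (i : ℕ), 1 ≤ i → i ≤ m →
      ∀ t : ℕ, ((i, t) ∈ p j ↔ lo j i ≤ t ∧ t ≤ hi j i))
    (z : List ℚ) (hzlen : z.length = m)
    (hzmin : ∀ z' : List ℚ, z'.length = m →
      ∑ j : Fin k, w j * alignCost z (x j) (p j) ≤
        ∑ j : Fin k, w j * alignCost z' (x j) (p j)) :
    ∀ i : ℕ, 1 ≤ i → i ≤ m →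
      z.getD (i - 1) 0 =
        (∑ j : Fin k, w j * ∑ t ∈ Finset.Icc (lo j i) (hi j i),
            (x j).getD (t - 1) 0) /
        (∑ j : Fin k, w j * ((hi j i - lo j i + 1 : ℕ) : ℚ)) := by
  intro i hi1 him
  have hle : ∀ j, lo j i ≤ hi j i := fun j => by
    obtain ⟨t, ht⟩ := (hp j).exists_mem hi1 him
    have := (halign j i hi1 him t).mp ht
    omega
  set W : ℚ := ∑ j : Fin k, w j * ((hi j i - lo j i + 1 : ℕ) : ℚ) with hW
  set S : ℚ := ∑ j : Fin k, w j * ∑ t ∈ Finset.Icc (lo j i) (hi j i),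
    (x j).getD (t - 1) 0 with hS
  set v : ℚ := z.getD (i - 1) 0 with hv
  have hWpos : 0 < W := by
    obtain ⟨j, hj⟩ := hwpos
    exact Finset.sum_pos' (fun j _ => mul_nonneg (hw j) (Nat.cast_nonneg _))
      ⟨j, Finset.mem_univ j, mul_pos hj (by positivity)⟩
  have hdiff : ∀ c : ℚ, 0 ≤ (c ^ 2 - v ^ 2) * W - 2 * (c - v) * S := by
    intro c
    have hmin := hzmin (z.set (i - 1) c) (by rw [List.length_set, hzlen])
    rw [← sub_nonneg, ← Finset.sum_sub_distrib] at hmin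
    refine hmin.trans_eq ?_
    rw [hW, hS, Finset.mul_sum, Finset.mul_sum, ← Finset.sum_sub_distrib]
    refine Finset.sum_congr rfl fun j _ => ?_
    have hcard : (((Finset.Icc (lo j i) (hi j i)).card : ℕ) : ℚ) =
        ((hi j i - lo j i + 1 : ℕ) : ℚ) := by
      have := hle j
      rw [Nat.card_Icc]
      congr 1
      omega
    rw [← mul_sub, alignCost_set_sub (hp j) z (x j) hzlen hi1 him (halign j i hi1 him), ← hv,
      ← hcard]
    have hterm : ∀ y : ℚ, (c - y) ^ 2 - (v - y) ^ 2 = (c ^ 2 - v ^ 2) - 2 * (c - v) * y :=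
      fun y => by ring
    simp only [hterm]
    rw [Finset.sum_sub_distrib, ← Finset.mul_sum, Finset.sum_const, nsmul_eq_mul]
    ring
  have hopt := hdiff (S / W)
  have hSW : S = S / W * W := (div_mul_cancel₀ S hWpos.ne').symm
  generalize S / W = r at hopt hSW ⊢
  rw [hSW] at hopt
  have hsq : (v - r) ^ 2 ≤ 0 := by
    by_contra! hpos
    nlinarith [mul_pos hpos hWpos]
  exact sub_eq_zero.mp (pow_eq_zero_iff two_ne_zero |>.mp (le_antisymm hsq (sq_nonneg _)))
end

section
/- For the sample consisting of x^(1) = (1, 4, 2, 3) and x^(2) = (4, 2, 4, 5), with Fréchet function F(z) = dtw(z, x^(1))² + dtw(z, x^(2))², the time series z = (2.5, 4, 2, 4) satisfies F(z) = 6.5, while the time series x̄ = (2.5, 4, 2, 3.5, 4) (the column-wise average of the alignment of x^(1) and x^(2) along their optimal warping path) satisfies F(x̄) = 7. Hence F(z) < F(x̄) and x̄ is not a mean of the sample. -/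
/-- The first sample time series `x⁽¹⁾ = (1,4,2,3)`. -/
def xOne : List ℚ := [1, 4, 2, 3]

/-- The second sample time series `x⁽²⁾ = (4,2,4,5)`. -/
def xTwo : List ℚ := [4, 2, 4, 5]

/-- The Fréchet function of the sample `(x⁽¹⁾, x⁽²⁾)`. -/
noncomputable def F (z : List ℚ) : ℝ := dtwSq z xOne + dtwSq z xTwo

/-- The moves allowed between consecutive pairs of a warping path. -/
def WarpingStep (q r : ℕ × ℕ) : Prop :=
  (r.1 = q.1 + 1 ∧ r.2 = q.2) ∨ (r.1 = q.1 ∧ r.2 = q.2 + 1) ∨ (r.1 = q.1 + 1 ∧ r.2 = q.2 + 1)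

theorem IsWarpingPath.isChain {m n : ℕ} {p : List (ℕ × ℕ)} (hp : IsWarpingPath m n p) :
    p.IsChain WarpingStep := by
  rw [List.isChain_iff_getElem]
  intro i hi
  have h := hp.2.2.2 i hi
  rwa [List.getD_eq_getElem _ _ hi, List.getD_eq_getElem _ _ (Nat.lt_of_succ_lt hi)] at h

theorem isWarpingPath_iff_isChain {m n : ℕ} {p : List (ℕ × ℕ)} :
    IsWarpingPath m n p ↔ p.head? = some (1, 1) ∧ p.getLast? = some (m, n) ∧
      (∀ q ∈ p, 1 ≤ q.1 ∧ q.1 ≤ m ∧ 1 ≤ q.2 ∧ q.2 ≤ n) ∧ p.IsChain WarpingStep := by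
  refine ⟨fun hp => ⟨hp.1, hp.2.1, hp.2.2.1, hp.isChain⟩, fun ⟨h₁, h₂, h₃, h₄⟩ => ⟨h₁, h₂, h₃, ?_⟩⟩
  intro i hi
  rw [List.getD_eq_getElem _ _ hi, List.getD_eq_getElem _ _ (Nat.lt_of_succ_lt hi)]
  exact List.isChain_iff_getElem.1 h₄ i hi

/-- The potential on index pairs read off from a table of rationals. -/
def tablePotential (T : List (List ℚ)) (q : ℕ × ℕ) : ℚ :=
  (T.getD (q.1 - 1) []).getD (q.2 - 1) 0

/-- The cost of aligning the entries of `x` and `y` at a pair of indices. -/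
def pairCost (x y : List ℚ) (q : ℕ × ℕ) : ℚ :=
  (x.getD (q.1 - 1) 0 - y.getD (q.2 - 1) 0) ^ 2

/-- A function on index pairs that is at most the local cost at the final pair, and drops along
each step by at most the local cost. -/
structure IsPotential (x y : List ℚ) (V : ℕ × ℕ → ℚ) : Prop where
  last : V (x.length, y.length) ≤ pairCost x y (x.length, y.length)
  down : ∀ i ∈ Finset.Icc 1 x.length, ∀ j ∈ Finset.Icc 1 y.length, i + 1 ≤ x.length →
    V (i, j) ≤ pairCost x y (i, j) + V (i + 1, j)
  right : ∀ i ∈ Finset.Icc 1 x.length, ∀ j ∈ Finset.Icc 1 y.length, j + 1 ≤ y.length →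
    V (i, j) ≤ pairCost x y (i, j) + V (i, j + 1)
  diag : ∀ i ∈ Finset.Icc 1 x.length, ∀ j ∈ Finset.Icc 1 y.length, i + 1 ≤ x.length →
    j + 1 ≤ y.length → V (i, j) ≤ pairCost x y (i, j) + V (i + 1, j + 1)

theorem IsPotential.le_pairCost_add {x y : List ℚ} {V : ℕ × ℕ → ℚ} (hV : IsPotential x y V)
    {q r : ℕ × ℕ} (hq : 1 ≤ q.1 ∧ q.1 ≤ x.length ∧ 1 ≤ q.2 ∧ q.2 ≤ y.length)
    (hr : 1 ≤ r.1 ∧ r.1 ≤ x.length ∧ 1 ≤ r.2 ∧ r.2 ≤ y.length) (h : WarpingStep q r) :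
    V q ≤ pairCost x y q + V r := by
  obtain ⟨i, j⟩ := q
  obtain ⟨k, l⟩ := r
  have hi := Finset.mem_Icc.2 ⟨hq.1, hq.2.1⟩
  have hj := Finset.mem_Icc.2 ⟨hq.2.2.1, hq.2.2.2⟩
  rcases h with ⟨h₁, h₂⟩ | ⟨h₁, h₂⟩ | ⟨h₁, h₂⟩ <;> dsimp only at h₁ h₂ <;> subst h₁ h₂
  · exact hV.down _ hi _ hj hr.2.1
  · exact hV.right _ hi _ hj hr.2.2.2
  · exact hV.diag _ hi _ hj hr.2.1 hr.2.2.2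

theorem IsPotential.le_alignCost_cons {x y : List ℚ} {V : ℕ × ℕ → ℚ} (hV : IsPotential x y V)
    (p : List (ℕ × ℕ)) (q : ℕ × ℕ) (hlast : (q :: p).getLast? = some (x.length, y.length))
    (hbox : ∀ r ∈ q :: p, 1 ≤ r.1 ∧ r.1 ≤ x.length ∧ 1 ≤ r.2 ∧ r.2 ≤ y.length)
    (hchain : (q :: p).IsChain WarpingStep) : V q ≤ alignCost x y (q :: p) := by
  induction p generalizing q with
  | nil =>
    obtain rfl : q = (x.length, y.length) := by simpa using hlast
    simpa [alignCost, pairCost] using hV.last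
  | cons r p ih =>
    rw [List.isChain_cons_cons] at hchain
    have hr := ih r (by simpa using hlast) (fun s hs => hbox s (List.mem_cons_of_mem _ hs))
      hchain.2
    have hq := hV.le_pairCost_add (hbox q (by simp)) (hbox r (by simp)) hchain.1
    have hcost : alignCost x y (q :: r :: p) = pairCost x y q + alignCost x y (r :: p) := by
      simp [alignCost, pairCost]
    linarith

theorem IsPotential.le_alignCost {x y : List ℚ} {V : ℕ × ℕ → ℚ} (hV : IsPotential x y V)
    {p : List (ℕ × ℕ)} (hp : IsWarpingPath x.length y.length p) :
    V (1, 1) ≤ alignCost x y p := by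
  obtain ⟨hhead, hlast, hbox, hchain⟩ := isWarpingPath_iff_isChain.1 hp
  obtain ⟨p, rfl⟩ := List.head?_eq_some_iff.1 hhead
  exact hV.le_alignCost_cons p (1, 1) hlast hbox hchain

theorem IsPotential.dtwSq_eq {x y : List ℚ} {V : ℕ × ℕ → ℚ} (hV : IsPotential x y V)
    {p : List (ℕ × ℕ)} (hp : IsWarpingPath x.length y.length p)
    (hcost : alignCost x y p = V (1, 1)) : dtwSq x y = (V (1, 1) : ℚ) := by
  refine IsLeast.csInf_eq ⟨⟨p, hp, by rw [hcost]⟩, ?_⟩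
  rintro c ⟨r, hr, rfl⟩
  exact_mod_cast hV.le_alignCost hr

theorem dtwSq_shorter_xOne : dtwSq [5/2, 4, 2, 4] xOne = 13/4 := by
  have hV : IsPotential [5/2, 4, 2, 4] xOne (tablePotential
      [[13/4, 13/4, 13/4, 13/4], [10, 1, 5, 3], [6, 5, 1, 2], [14, 5, 5, 1]]) := by
    constructor <;> decide +kernel
  have hp : IsWarpingPath 4 4 [(1, 1), (2, 2), (3, 3), (4, 4)] :=
    isWarpingPath_iff_isChain.2 (by simp [WarpingStep])
  rw [hV.dtwSq_eq hp (by decide +kernel)]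
  norm_num [tablePotential]

theorem dtwSq_shorter_xTwo : dtwSq [5/2, 4, 2, 4] xTwo = 13/4 := by
  have hV : IsPotential [5/2, 4, 2, 4] xTwo (tablePotential
      [[13/4, 21/4, 29/4, 69/4], [1, 5, 5, 11], [5, 1, 5, 10], [5, 5, 1, 1]]) := by
    constructor <;> decide +kernel
  have hp : IsWarpingPath 4 4 [(1, 1), (2, 1), (3, 2), (4, 3), (4, 4)] :=
    isWarpingPath_iff_isChain.2 (by simp [WarpingStep])
  rw [hV.dtwSq_eq hp (by decide +kernel)]
  norm_num [tablePotential]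

theorem dtwSq_average_xOne : dtwSq [5/2, 4, 2, 7/2, 4] xOne = 7/2 := by
  have hV : IsPotential [5/2, 4, 2, 7/2, 4] xOne (tablePotential
      [[7/2, 7/2, 7/2, 7/2], [41/4, 5/4, 21/4, 13/4], [9/2, 21/4, 5/4, 9/4],
        [39/4, 7/2, 13/4, 5/4], [14, 5, 5, 1]]) := by
    constructor <;> decide +kernel
  have hp : IsWarpingPath 5 4 [(1, 1), (2, 2), (3, 3), (4, 4), (5, 4)] :=
    isWarpingPath_iff_isChain.2 (by simp [WarpingStep])
  rw [hV.dtwSq_eq hp (by decide +kernel)]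
  norm_num [tablePotential]

theorem dtwSq_average_xTwo : dtwSq [5/2, 4, 2, 7/2, 4] xTwo = 7/2 := by
  have hV : IsPotential [5/2, 4, 2, 7/2, 4] xTwo (tablePotential
      [[7/2, 11/2, 15/2, 39/2], [5/4, 21/4, 21/4, 53/4], [21/4, 5/4, 21/4, 49/4],
        [7/2, 13/4, 5/4, 13/4], [5, 5, 1, 1]]) := by
    constructor <;> decide +kernel
  have hp : IsWarpingPath 5 4 [(1, 1), (2, 1), (3, 2), (4, 3), (5, 4)] :=
    isWarpingPath_iff_isChain.2 (by simp [WarpingStep])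
  rw [hV.dtwSq_eq hp (by decide +kernel)]
  norm_num [tablePotential]

/-- `F((2.5,4,2,4)) = 6.5` while the multiple-alignment average
`x̄ = (2.5,4,2,3.5,4)` has `F(x̄) = 7`; hence `F(z) < F(x̄)` and `x̄` is not a
mean of the sample. -/
theorem ma_average_not_mean :
    F [5/2, 4, 2, 4] = 6.5 ∧
    F [5/2, 4, 2, 7/2, 4] = 7 ∧
    F [5/2, 4, 2, 4] < F [5/2, 4, 2, 7/2, 4] ∧
    ¬ (∀ z' : List ℚ, z' ≠ [] → F [5/2, 4, 2, 7/2, 4] ≤ F z') := by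
  have hz : F [5/2, 4, 2, 4] = 6.5 := by
    rw [F, dtwSq_shorter_xOne, dtwSq_shorter_xTwo]
    norm_num
  have hx : F [5/2, 4, 2, 7/2, 4] = 7 := by
    rw [F, dtwSq_average_xOne, dtwSq_average_xTwo]
    norm_num
  have hlt : F [5/2, 4, 2, 4] < F [5/2, 4, 2, 7/2, 4] := by
    rw [hz, hx]
    norm_num
  exact ⟨hz, hx, hlt, fun h => (h _ (by simp)).not_gt hlt⟩
end
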